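/- Let k ≥ 2, m : ℝ, n ≥ 1, and let ω : Fin k → ℝ be a weight vector. Then T_m(P_{n,ω}) = 0 if and only if T_m(S_ω(γ)) = 0 for every string generator γ : Fin k → ℕ with γ₁ ∈ {0,1} whose isobaric degree equals n. (A weighted isobaric polynomial is a solution of T_m = 0 if and only if all the strings belonging to it are solutions.) -/

import Mathlib

open MvPolynomial Finset

/-- The weight coefficient `A_ω(α)` of Theorem 2.1 (for `α ≠ 0`):
`A_ω(α) = multinomial(α) · (Σ α_i ω_i) / (Σ α_i)`. -/
noncomputable def Aw {k : ℕ} (ω : Fin k → ℝ) (α : Fin k → ℕ) : ℝ :=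
  (Nat.multinomial Finset.univ α : ℝ) * (∑ i, (α i : ℝ) * ω i) / (∑ i, (α i : ℝ))

/-- The isobaric degree `Σ_{i=1}^k i·α_i` of an exponent vector. -/
def isoDeg {k : ℕ} (α : Fin k → ℕ) : ℕ := ∑ i, (i.1 + 1) * α i

/-- The (finite) set of exponent vectors of isobaric degree `n`. -/
def wipIndex (k n : ℕ) : Finset (Fin k → ℕ) :=
  (Fintype.piFinset fun _ : Fin k => Finset.range (n + 1)).filter fun α => isoDeg α = n

/-- The weighted isobaric polynomial `P_{n,ω} = Σ_α A_ω(α)·t^α`. -/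
noncomputable def WIP (k n : ℕ) (ω : Fin k → ℝ) : MvPolynomial (Fin k) ℝ :=
  ∑ α ∈ wipIndex k n, MvPolynomial.monomial (Finsupp.equivFunOnFinite.symm α) (Aw ω α)

/-- The operator `T_m(P) = D₁₁P − Σ_j t_j D_{2j}P − m·D₂P`. -/
noncomputable def Tm (k : ℕ) (hk : 2 ≤ k) (m : ℝ) (P : MvPolynomial (Fin k) ℝ) :
    MvPolynomial (Fin k) ℝ :=
  pderiv (⟨0, by omega⟩ : Fin k) (pderiv (⟨0, by omega⟩ : Fin k) P)
    - ∑ j : Fin k, X j * pderiv (⟨1, by omega⟩ : Fin k) (pderiv j P)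
    - C m * pderiv (⟨1, by omega⟩ : Fin k) P

/-- The `j`-th element `γ^{(j)}` of the string generated by `γ`. -/
def strElem (k : ℕ) (hk : 2 ≤ k) (γ : Fin k → ℕ) (j : ℕ) : Fin k → ℕ :=
  fun i => if i = (⟨0, by omega⟩ : Fin k) then γ i + 2 * j
    else if i = (⟨1, by omega⟩ : Fin k) then γ i - j else γ i

/-- The `ω`-weighted string generated by `γ`:
`S_ω(γ) = Σ_{j=0}^{γ₂} A_ω(γ^{(j)})·t^{γ^{(j)}}`. -/
noncomputable def strPoly (k : ℕ) (hk : 2 ≤ k) (ω : Fin k → ℝ) (γ : Fin k → ℕ) :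
    MvPolynomial (Fin k) ℝ :=
  ∑ j ∈ Finset.range (γ (⟨1, by omega⟩ : Fin k) + 1),
    MvPolynomial.monomial (Finsupp.equivFunOnFinite.symm (strElem k hk γ j))
      (Aw ω (strElem k hk γ j))

/-- The generator of the string containing the exponent vector `α`. -/
def strGen (k : ℕ) (hk : 2 ≤ k) (α : Fin k → ℕ) : Fin k → ℕ :=
  fun i => if i = (⟨0, by omega⟩ : Fin k) then α i % 2
    else if i = (⟨1, by omega⟩ : Fin k) then α i + α ⟨0, by omega⟩ / 2 else α i

/-- `β` with its second exponent raised by one. -/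
def raiseSnd (k : ℕ) (hk : 2 ≤ k) (β : Fin k → ℕ) : Fin k → ℕ :=
  fun i => if i = (⟨1, by omega⟩ : Fin k) then β i + 1 else β i

lemma mem_wipIndex {k n : ℕ} {α : Fin k → ℕ} : α ∈ wipIndex k n ↔ isoDeg α = n := by
  simp only [wipIndex, mem_filter, Fintype.mem_piFinset, mem_range, and_iff_right_iff_imp]
  rintro rfl i
  have h : (i.1 + 1) * α i ≤ isoDeg α :=
    Finset.single_le_sum (f := fun i : Fin k => (i.1 + 1) * α i) (fun _ _ => Nat.zero_le _)
      (Finset.mem_univ i)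
  have : α i ≤ (i.1 + 1) * α i := Nat.le_mul_of_pos_left _ (Nat.succ_pos _)
  omega

lemma strGen_strElem (k : ℕ) (hk : 2 ≤ k) {γ : Fin k → ℕ} {j : ℕ}
    (hγ : γ (⟨0, by omega⟩ : Fin k) = 0 ∨ γ (⟨0, by omega⟩ : Fin k) = 1)
    (hj : j ≤ γ ⟨1, by omega⟩) : strGen k hk (strElem k hk γ j) = γ := by
  funext i
  simp only [strGen, strElem]
  split_ifs <;> simp_all <;> omega

lemma strElem_strGen (k : ℕ) (hk : 2 ≤ k) (α : Fin k → ℕ) :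
    strElem k hk (strGen k hk α) (α ⟨0, by omega⟩ / 2) = α := by
  funext i
  simp only [strGen, strElem]
  split_ifs <;> simp_all
  omega

lemma isoDeg_strElem (k : ℕ) (hk : 2 ≤ k) {γ : Fin k → ℕ} {j : ℕ}
    (hj : j ≤ γ ⟨1, by omega⟩) : isoDeg (strElem k hk γ j) = isoDeg γ := by
  obtain ⟨k, rfl⟩ := Nat.exists_eq_add_of_le' hk
  have hj' : j ≤ γ (Fin.succ 0) := hj
  have h2 : ∀ i : Fin k, strElem (k + 2) hk γ j i.succ.succ = γ i.succ.succ := fun i => by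
    simp [strElem, Fin.ext_iff]
  have h0 : strElem (k + 2) hk γ j 0 = γ 0 + 2 * j := by simp [strElem]
  have h1 : strElem (k + 2) hk γ j (Fin.succ 0) = γ (Fin.succ 0) - j := by
    simp [strElem]
  simp only [isoDeg, Fin.sum_univ_succ, h0, h1, h2]
  simp only [Fin.val_zero, Fin.val_succ]
  omega

lemma half_fst_le_strGen (k : ℕ) (hk : 2 ≤ k) (α : Fin k → ℕ) :
    α ⟨0, by omega⟩ / 2 ≤ strGen k hk α ⟨1, by omega⟩ := by
  simp [strGen]

lemma isoDeg_strGen (k : ℕ) (hk : 2 ≤ k) (α : Fin k → ℕ) :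
    isoDeg (strGen k hk α) = isoDeg α := by
  conv_rhs => rw [← strElem_strGen k hk α]
  exact (isoDeg_strElem k hk (half_fst_le_strGen k hk α)).symm

lemma strPoly_eq_sum_filter (k : ℕ) (hk : 2 ≤ k) (ω : Fin k → ℝ) {γ : Fin k → ℕ}
    (hγ : γ (⟨0, by omega⟩ : Fin k) = 0 ∨ γ (⟨0, by omega⟩ : Fin k) = 1) :
    strPoly k hk ω γ = ∑ α ∈ (wipIndex k (isoDeg γ)).filter (strGen k hk · = γ),
      MvPolynomial.monomial (Finsupp.equivFunOnFinite.symm α) (Aw ω α) := by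
  refine Finset.sum_nbij' (strElem k hk γ) (fun α => α ⟨0, by omega⟩ / 2) ?_ ?_ ?_ ?_ ?_
  · intro j hj
    have hj := Nat.lt_succ_iff.mp (mem_range.mp hj)
    exact mem_filter.mpr ⟨mem_wipIndex.mpr (isoDeg_strElem k hk hj), strGen_strElem k hk hγ hj⟩
  · intro α hα
    obtain ⟨-, rfl⟩ := mem_filter.mp hα
    exact mem_range.mpr (Nat.lt_succ_iff.mpr (half_fst_le_strGen k hk α))
  · intro j _
    simp only [strElem, if_true]
    omega
  · intro α hα
    obtain ⟨-, rfl⟩ := mem_filter.mp hα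
    exact strElem_strGen k hk α
  · intro _ _
    rfl

lemma Tm_sum (k : ℕ) (hk : 2 ≤ k) (m : ℝ) {ι : Type*} (s : Finset ι)
    (f : ι → MvPolynomial (Fin k) ℝ) :
    Tm k hk m (∑ a ∈ s, f a) = ∑ a ∈ s, Tm k hk m (f a) := by
  simp only [Tm, map_sum, Finset.mul_sum, Finset.sum_sub_distrib]
  rw [Finset.sum_comm]

/-- `Tm` sends a monomial of one string into the span of the monomials of the string
whose generator has second exponent one lower. -/
lemma coeff_Tm_monomial_eq_zero (k : ℕ) (hk : 2 ≤ k) (m a : ℝ) (α β : Fin k →₀ ℕ)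
    (h : strGen k hk α ≠ raiseSnd k hk (strGen k hk β)) :
    coeff β (Tm k hk m (monomial α a)) = 0 := by
  have hne : α ≠ β + Finsupp.single ⟨0, by omega⟩ 2 ∧
      α ≠ β + Finsupp.single ⟨1, by omega⟩ 1 := by
    constructor <;>
    · rintro rfl
      refine h (funext fun i => ?_)
      by_cases h0 : i = ⟨0, by omega⟩
      · subst h0
        simp [strGen, raiseSnd]
      · by_cases h1 : i = ⟨1, by omega⟩
        · subst h1
          simp [strGen, raiseSnd]
          omega
        · simp [strGen, raiseSnd, h0, h1]
  obtain ⟨hfst, hsnd⟩ := hne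
  simp only [Tm, coeff_sub, coeff_sum, pderiv_monomial, coeff_C_mul]
  have hD₁₁ : coeff β (monomial
      (α - Finsupp.single ⟨0, by omega⟩ 1 - Finsupp.single ⟨0, by omega⟩ 1)
      (a * α ⟨0, by omega⟩ *
        ((α - Finsupp.single ⟨0, by omega⟩ 1 : Fin k →₀ ℕ) ⟨0, by omega⟩ : ℕ))) = 0 := by
    rw [coeff_monomial, ite_eq_right_iff]
    intro hβ
    by_cases h2 : α ⟨0, by omega⟩ < 2
    · obtain h3 | h3 : α ⟨0, by omega⟩ = 0 ∨ α ⟨0, by omega⟩ - 1 = 0 := by omega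
      · simp [h3]
      · simp [h3]
    · refine absurd ?_ hfst
      rw [← hβ]
      ext i
      by_cases hi : i = ⟨0, by omega⟩
      · subst hi
        simp
        omega
      · simp [Ne.symm hi]
  have hD₂ : coeff β (monomial (α - Finsupp.single ⟨1, by omega⟩ 1)
      (a * α ⟨1, by omega⟩)) = 0 := by
    rw [coeff_monomial, ite_eq_right_iff]
    intro hβ
    by_cases h2 : α ⟨1, by omega⟩ = 0
    · simp [h2]
    · refine absurd ?_ hsnd
      rw [← hβ, tsub_add_cancel_of_le]
      rw [Finsupp.single_le_iff]
      omega
  have hD₂ⱼ : ∀ j : Fin k, coeff β (X j * monomial (α - Finsupp.single j 1 -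
      Finsupp.single ⟨1, by omega⟩ 1)
      (a * α j * ((α - Finsupp.single j 1 : Fin k →₀ ℕ) ⟨1, by omega⟩ : ℕ))) = 0 := by
    intro j
    rw [X, monomial_mul, coeff_monomial, ite_eq_right_iff]
    intro hβ
    by_cases hj : α j = 0
    · simp [hj]
    by_cases h2 : (α - Finsupp.single j 1 : Fin k →₀ ℕ) ⟨1, by omega⟩ = 0
    · simp [h2]
    · refine absurd ?_ hsnd
      rw [← hβ, add_assoc, tsub_add_cancel_of_le, add_tsub_cancel_of_le]
      · rw [Finsupp.single_le_iff]
        omega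
      · rw [Finsupp.single_le_iff]
        omega
  rw [hD₁₁, hD₂, Finset.sum_eq_zero fun j _ => hD₂ⱼ j]
  ring

lemma coeff_Tm_WIP (k : ℕ) (hk : 2 ≤ k) (m : ℝ) (n : ℕ) (ω : Fin k → ℝ) (β : Fin k →₀ ℕ) :
    coeff β (Tm k hk m (WIP k n ω)) =
      ∑ α ∈ (wipIndex k n).filter (strGen k hk · = raiseSnd k hk (strGen k hk β)),
        coeff β (Tm k hk m (monomial (Finsupp.equivFunOnFinite.symm α) (Aw ω α))) := by
  rw [WIP, Tm_sum, coeff_sum, Finset.sum_filter_of_ne]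
  intro α _ hne
  by_contra h
  exact hne (coeff_Tm_monomial_eq_zero k hk m _ _ β h)

/-- Theorem 4.5: `P_{n,ω}` is a solution of `T_m = 0` iff every string belonging
to it (i.e. every string whose generator has isobaric degree `n`) is a solution. -/
theorem wip_solution_iff_strings (k : ℕ) (hk : 2 ≤ k) (m : ℝ) (n : ℕ) (hn : 1 ≤ n)
    (ω : Fin k → ℝ) :
    Tm k hk m (WIP k n ω) = 0 ↔
      ∀ γ : Fin k → ℕ,
        (γ (⟨0, by omega⟩ : Fin k) = 0 ∨ γ (⟨0, by omega⟩ : Fin k) = 1) →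
        isoDeg γ = n → Tm k hk m (strPoly k hk ω γ) = 0 := by
  constructor
  · intro hP γ hγ hn'
    ext β
    rw [strPoly_eq_sum_filter k hk ω hγ, Tm_sum, coeff_sum, coeff_zero, hn']
    by_cases h : γ = raiseSnd k hk (strGen k hk β)
    · rw [h, ← coeff_Tm_WIP, hP, coeff_zero]
    · refine Finset.sum_eq_zero fun α hα => coeff_Tm_monomial_eq_zero k hk m _ _ β ?_
      have hα' := (mem_filter.mp hα).2
      exact fun h' => h (hα'.symm.trans h')
  · intro hS
    ext β
    rw [coeff_Tm_WIP, coeff_zero]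
    set γ := raiseSnd k hk (strGen k hk β) with hγdef
    by_cases hd : isoDeg γ = n
    · have hγ : γ (⟨0, by omega⟩ : Fin k) = 0 ∨ γ (⟨0, by omega⟩ : Fin k) = 1 := by
        simp only [hγdef, raiseSnd, strGen, Fin.mk.injEq]
        simp only [zero_ne_one, if_false, if_true]
        omega
      have := hS γ hγ hd
      rw [strPoly_eq_sum_filter k hk ω hγ, Tm_sum, hd] at this
      rw [← coeff_sum, this, coeff_zero]
    · refine Finset.sum_eq_zero fun α hα => absurd ?_ hd
      obtain ⟨hα, hα'⟩ := mem_filter.mp hα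
      rw [← hα', isoDeg_strGen, mem_wipIndex.mp hα]
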